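/- arXiv:1512.00780 — 2 statements merged into one kernel-verified Lean document; each statement's English description precedes it below -/
import Mathlib

section
/- Let ξ be an extremal number (so that w_2(ξ) = 2+√5). Then ŵ_3(ξ) ≤ 4. -/
open Polynomial Filter

/-- Height of an integer polynomial: the maximum absolute value of its coefficients. -/
noncomputable def polyHeight (P : Polynomial ℤ) : ℝ :=
  ((P.support.sup fun i => (P.coeff i).natAbs : ℕ) : ℝ)

/-- `P` and `Q` have no common non-constant factor in `ℤ[X]`. -/
def CoprimePoly (P Q : Polynomial ℤ) : Prop :=
  ∀ d : Polynomial ℤ, d ∣ P → d ∣ Q → d.natDegree = 0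

/-- The exponent `w_n(ξ)`. -/
noncomputable def wExp (n : ℕ) (ξ : ℝ) : EReal :=
  sSup {x : EReal | ∃ w : ℝ, x = (w : EReal) ∧
    {P : Polynomial ℤ | P.natDegree ≤ n ∧ 0 < |Polynomial.aeval ξ P| ∧
      |Polynomial.aeval ξ P| ≤ (polyHeight P) ^ (-w)}.Infinite}

/-- The uniform exponent `ŵ_n(ξ)`. -/
noncomputable def whExp (n : ℕ) (ξ : ℝ) : EReal :=
  sSup {x : EReal | ∃ w : ℝ, x = (w : EReal) ∧
    ∀ᶠ H : ℝ in atTop, ∃ P : Polynomial ℤ, P.natDegree ≤ n ∧ polyHeight P ≤ H ∧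
      0 < |Polynomial.aeval ξ P| ∧ |Polynomial.aeval ξ P| ≤ H ^ (-w)}

/-- The exponent `w*_n(ξ)` of approximation by algebraic numbers of degree at most `n`;
the height of an algebraic number is the height of its irreducible defining polynomial. -/
noncomputable def wStarExp (n : ℕ) (ξ : ℝ) : EReal :=
  sSup {x : EReal | ∃ w : ℝ, x = (w : EReal) ∧
    {α : ℝ | ∃ P : Polynomial ℤ, Irreducible P ∧ Polynomial.aeval α P = 0 ∧
      P.natDegree ≤ n ∧ 0 < |ξ - α| ∧ |ξ - α| ≤ (polyHeight P) ^ (-w - 1)}.Infinite}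

/-- The uniform exponent `ŵ*_n(ξ)`. -/
noncomputable def whStarExp (n : ℕ) (ξ : ℝ) : EReal :=
  sSup {x : EReal | ∃ w : ℝ, x = (w : EReal) ∧
    ∀ᶠ H : ℝ in atTop, ∃ α : ℝ, ∃ P : Polynomial ℤ, Irreducible P ∧
      Polynomial.aeval α P = 0 ∧ P.natDegree ≤ n ∧ polyHeight P ≤ H ∧
      0 < |ξ - α| ∧ |ξ - α| ≤ (polyHeight P)⁻¹ * H ^ (-w)}

theorem abs_coeff_le_polyHeight (P : ℤ[X]) (i : ℕ) : |(P.coeff i : ℝ)| ≤ polyHeight P := by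
  by_cases hi : i ∈ P.support
  · have h := Finset.le_sup (f := fun i => (P.coeff i).natAbs) hi
    have h' : (((P.coeff i).natAbs : ℕ) : ℝ) ≤ polyHeight P := by
      unfold polyHeight
      exact_mod_cast h
    simpa [Nat.cast_natAbs] using h'
  · rw [notMem_support_iff.mp hi]
    simp [polyHeight]

theorem one_le_polyHeight {P : ℤ[X]} (hP : P ≠ 0) : 1 ≤ polyHeight P := by
  refine le_trans ?_ (abs_coeff_le_polyHeight P P.natDegree)
  have h : 1 ≤ |P.coeff P.natDegree| := Int.one_le_abs (leadingCoeff_ne_zero.mpr hP)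
  exact_mod_cast h

/-- The Mahler measure of an integer polynomial. -/
noncomputable def intMahlerMeasure (P : ℤ[X]) : ℝ :=
  (P.map (Int.castRingHom ℂ)).mahlerMeasure

theorem one_le_intMahlerMeasure {P : ℤ[X]} (hP : P ≠ 0) : 1 ≤ intMahlerMeasure P :=
  one_le_mahlerMeasure_of_ne_zero hP

theorem intMahlerMeasure_mul (P Q : ℤ[X]) :
    intMahlerMeasure (P * Q) = intMahlerMeasure P * intMahlerMeasure Q := by
  simp [intMahlerMeasure, mahlerMeasure_mul]

theorem intMahlerMeasure_le_of_dvd {P Q : ℤ[X]} (h : P ∣ Q) (hQ : Q ≠ 0) :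
    intMahlerMeasure P ≤ intMahlerMeasure Q := by
  obtain ⟨R, rfl⟩ := h
  rw [intMahlerMeasure_mul]
  exact le_mul_of_one_le_right (mahlerMeasure_nonneg _)
    (one_le_intMahlerMeasure (right_ne_zero_of_mul hQ))

theorem abs_coeff_le_two_pow_mul_intMahlerMeasure (P : ℤ[X]) (i : ℕ) :
    |(P.coeff i : ℝ)| ≤ 2 ^ P.natDegree * intMahlerMeasure P := by
  have h := (P.map (Int.castRingHom ℂ)).norm_coeff_le_choose_mul_mahlerMeasure i
  rw [natDegree_map_eq_of_injective (Int.castRingHom ℂ).injective_int] at h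
  have h2 : ((P.natDegree.choose i : ℕ) : ℝ) ≤ 2 ^ P.natDegree := by
    exact_mod_cast Nat.choose_le_two_pow _ _
  calc |(P.coeff i : ℝ)| = ‖(P.map (Int.castRingHom ℂ)).coeff i‖ := by simp
    _ ≤ _ := h
    _ ≤ _ := mul_le_mul_of_nonneg_right h2 (mahlerMeasure_nonneg _)

theorem intMahlerMeasure_le_polyHeight {P : ℤ[X]} {n : ℕ} (hP : P.natDegree ≤ n) :
    intMahlerMeasure P ≤ (n + 1) * polyHeight P := by
  refine (mahlerMeasure_le_sum_norm_coeff _).trans ?_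
  rw [sum_over_range' _ (by simp) (n + 1) ((natDegree_map_le.trans hP).trans_lt (Nat.lt_succ_self n))]
  calc _ ≤ ∑ _i ∈ Finset.range (n + 1), polyHeight P :=
        Finset.sum_le_sum fun i _ => by simpa using abs_coeff_le_polyHeight P i
    _ = _ := by simp

theorem finite_intMahlerMeasure_le (n : ℕ) (B : ℝ) :
    {P : ℤ[X] | P.natDegree ≤ n ∧ intMahlerMeasure P ≤ B}.Finite :=
  (finite_mahlerMeasure_le n B.toNNReal).subset fun _ hP =>
    ⟨hP.1, hP.2.trans (Real.le_coe_toNNReal B)⟩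

/-- A nonzero integer determinant formed by the coefficients of linearly independent polynomials
prevents all of them from being small at the same point. -/
theorem one_le_of_linearIndependent {N : ℕ} (F : Fin (N + 1) → ℤ[X])
    (hdeg : ∀ i, (F i).natDegree ≤ N) (hF : LinearIndependent ℤ F) {ξ B ε : ℝ}
    (hB : ∀ i j, |((F i).coeff j : ℝ)| ≤ B) (hε : ∀ i, |aeval ξ (F i)| ≤ ε) :
    1 ≤ (N + 1).factorial * B ^ N * ε := by
  classical
  set A : Matrix (Fin (N + 1)) (Fin (N + 1)) ℤ := Matrix.of fun i j => (F i).coeff j with hA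
  have hdet : A.det ≠ 0 := by
    intro h0
    obtain ⟨v, hv, hvA⟩ := Matrix.exists_vecMul_eq_zero_iff.mpr h0
    refine hv (funext (Fintype.linearIndependent_iff.mp hF v ?_))
    ext k
    rw [finsetSum_coeff]
    by_cases hk : k < N + 1
    · simpa [Matrix.vecMul, dotProduct, hA] using congrFun hvA ⟨k, hk⟩
    · rw [coeff_zero]
      refine Finset.sum_eq_zero fun i _ => ?_
      rw [coeff_smul, coeff_eq_zero_of_natDegree_lt (by have := hdeg i; omega), smul_zero]
  set A' : Matrix (Fin (N + 1)) (Fin (N + 1)) ℝ := A.map (Int.castRingHom ℝ) with hA'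
  have hdet' : 1 ≤ |A'.det| := by
    have h : A'.det = (A.det : ℝ) := ((Int.castRingHom ℝ).map_det A).symm
    rw [h]
    exact_mod_cast Int.one_le_abs hdet
  have hval : A'.mulVec (fun j => ξ ^ (j : ℕ)) = fun i => aeval ξ (F i) := by
    funext i
    rw [aeval_eq_sum_range' (Nat.lt_succ_of_le (hdeg i)), Finset.sum_range]
    simp [Matrix.mulVec, dotProduct, hA', hA]
  have hadj : A'.det = ∑ j, A'.adjugate 0 j * aeval ξ (F j) := by
    have h : A'.adjugate.mulVec (A'.mulVec fun j => ξ ^ (j : ℕ)) =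
        A'.det • fun j : Fin (N + 1) => ξ ^ (j : ℕ) := by
      rw [Matrix.mulVec_mulVec, Matrix.adjugate_mul, Matrix.smul_mulVec, Matrix.one_mulVec]
    rw [hval] at h
    simpa [Matrix.mulVec, dotProduct] using (congrFun h 0).symm
  have hcof : ∀ j, |A'.adjugate 0 j| ≤ N.factorial * B ^ N := by
    intro j
    rw [Matrix.adjugate_fin_succ_eq_det_submatrix, abs_mul, abs_pow, abs_neg, abs_one, one_pow,
      one_mul]
    have h := Matrix.det_le (A := A'.submatrix j.succAbove (Fin.succAbove 0))
      (abv := AbsoluteValue.abs) (x := B) fun i k => by simpa [hA', hA] using hB _ _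
    simpa using h
  calc (1 : ℝ) ≤ |A'.det| := hdet'
    _ ≤ ∑ j, |A'.adjugate 0 j * aeval ξ (F j)| := by
      rw [hadj]
      exact Finset.abs_sum_le_sum_abs _ _
    _ ≤ ∑ _j : Fin (N + 1), N.factorial * B ^ N * ε := by
      refine Finset.sum_le_sum fun j _ => ?_
      rw [abs_mul]
      exact mul_le_mul (hcof j) (hε j) (abs_nonneg _) ((abs_nonneg _).trans (hcof j))
    _ = _ := by
      simp [Nat.factorial_succ]
      ring

/-- The shifts `X ^ j * Q` for `j < deg P` and `X ^ i * P` for `i < n`. -/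
noncomputable def shiftFamily (P Q : ℤ[X]) (n : ℕ) : Fin P.natDegree ⊕ Fin n → ℤ[X] :=
  Sum.elim (fun j => X ^ (j : ℕ) * Q) (fun i => X ^ (i : ℕ) * P)

theorem linearIndependent_shiftFamily {P Q : ℤ[X]} (hP : Irreducible P) (hPQ : ¬ P ∣ Q) (n : ℕ) :
    LinearIndependent ℤ (shiftFamily P Q n) := by
  classical
  rw [Fintype.linearIndependent_iff]
  intro g hg
  have key : ofFn P.natDegree (g ∘ Sum.inl) * Q + ofFn n (g ∘ Sum.inr) * P = 0 := by
    rw [← hg, Fintype.sum_sum_type, ofFn_eq_sum_monomial, ofFn_eq_sum_monomial, Finset.sum_mul,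
      Finset.sum_mul]
    simp [shiftFamily, ← C_mul_X_pow_eq_monomial, smul_eq_C_mul, mul_assoc]
  have hv : ofFn P.natDegree (g ∘ Sum.inl) = 0 := by
    refine eq_zero_of_dvd_of_degree_lt (p := P) ?_ ?_
    · refine (hP.prime.dvd_or_dvd ?_).resolve_right hPQ
      exact (dvd_add_left (dvd_mul_left _ _)).mp (key ▸ dvd_zero P)
    · rw [degree_eq_natDegree hP.ne_zero]
      exact ofFn_degree_lt _
  have hu : ofFn n (g ∘ Sum.inr) = 0 := by
    rw [hv, zero_mul, zero_add] at key
    exact (mul_eq_zero.mp key).resolve_right hP.ne_zero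
  rintro (j | i)
  · simpa [hv] using (ofFn_coeff_eq_val_of_lt (g ∘ Sum.inl) j.2).symm
  · simpa [hu] using (ofFn_coeff_eq_val_of_lt (g ∘ Sum.inr) i.2).symm

/-- Two integer polynomials, one of which is irreducible and does not divide the other, cannot
both be small at the same point. -/
theorem one_le_of_irreducible_of_not_dvd {P Q : ℤ[X]} (hP : Irreducible P) (hPQ : ¬ P ∣ Q)
    {m n : ℕ} (hPm : P.natDegree ≤ m) (hQn : Q.natDegree ≤ n + 1) {ξ B : ℝ} (hB : 1 ≤ B)
    (hBP : ∀ i, |(P.coeff i : ℝ)| ≤ B) (hBQ : ∀ i, |(Q.coeff i : ℝ)| ≤ B) :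
    1 ≤ (m + n + 1).factorial * B ^ (m + n) *
      (max 1 |ξ| ^ (m + n) * (|aeval ξ P| + |aeval ξ Q|)) := by
  have hX : (1 : ℝ) ≤ max 1 |ξ| := le_max_left _ _
  have hcoeff : ∀ (R : ℤ[X]), (∀ i, |(R.coeff i : ℝ)| ≤ B) → ∀ k i,
      |((X ^ k * R).coeff i : ℝ)| ≤ B := by
    intro R hR k i
    rw [coeff_X_pow_mul']
    split_ifs
    · exact hR _
    · simpa using zero_le_one.trans hB
  have hval : ∀ (R : ℤ[X]) (k : ℕ), k ≤ m + n →
      |aeval ξ (X ^ k * R)| ≤ max 1 |ξ| ^ (m + n) * |aeval ξ R| := by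
    intro R k hk
    rw [map_mul, map_pow, aeval_X, abs_mul, abs_pow]
    refine mul_le_mul_of_nonneg_right ?_ (abs_nonneg _)
    exact (pow_le_pow_left₀ (abs_nonneg _) (le_max_right _ _) k).trans (pow_le_pow_right₀ hX hk)
  have hX0 : (0 : ℝ) ≤ max 1 |ξ| ^ (m + n) := by positivity
  have hdeg : ∀ s, (shiftFamily P Q (n + 1) s).natDegree ≤ P.natDegree + n := by
    rintro (j | i)
    · refine natDegree_mul_le.trans ?_
      rw [natDegree_X_pow]
      omega
    · refine natDegree_mul_le.trans ?_
      rw [natDegree_X_pow]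
      omega
  have hcoeffs : ∀ s k, |((shiftFamily P Q (n + 1) s).coeff k : ℝ)| ≤ B := by
    rintro (j | i)
    · exact hcoeff Q hBQ j
    · exact hcoeff P hBP i
  have hvals : ∀ s, |aeval ξ (shiftFamily P Q (n + 1) s)| ≤
      max 1 |ξ| ^ (m + n) * (|aeval ξ P| + |aeval ξ Q|) := by
    rintro (j | i)
    · refine (hval Q j (by omega)).trans (mul_le_mul_of_nonneg_left ?_ hX0)
      exact le_add_of_nonneg_left (abs_nonneg _)
    · refine (hval P i (by omega)).trans (mul_le_mul_of_nonneg_left ?_ hX0)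
      exact le_add_of_nonneg_right (abs_nonneg _)
  let e : Fin P.natDegree ⊕ Fin (n + 1) ≃ Fin (P.natDegree + n + 1) := finSumFinEquiv
  have h := one_le_of_linearIndependent (shiftFamily P Q (n + 1) ∘ e.symm)
    (fun i => hdeg (e.symm i))
    ((linearIndependent_shiftFamily hP hPQ (n + 1)).comp _ e.symm.injective)
    (fun i => hcoeffs (e.symm i)) (fun i => hvals (e.symm i))
  refine h.trans ?_
  gcongr

/-- A uniform exponent larger than `m + n` in degree `n + 1` bounds irreducible polynomials of
degree at most `m` from below. -/
theorem exists_lower_bound_of_irreducible {ξ : ℝ} (hξ : ∀ P : ℤ[X], P ≠ 0 → aeval ξ P ≠ 0)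
    {m n : ℕ} {w : ℝ} (hw : ((m + n : ℕ) : ℝ) < w)
    (hunif : ∀ᶠ H : ℝ in atTop, ∃ P : ℤ[X], P.natDegree ≤ n + 1 ∧ polyHeight P ≤ H ∧
      0 < |aeval ξ P| ∧ |aeval ξ P| ≤ H ^ (-w)) :
    ∃ c : ℝ, 0 < c ∧ c ≤ 1 ∧ ∀ P : ℤ[X], Irreducible P → P.natDegree ≤ m →
      c ≤ |aeval ξ P| * intMahlerMeasure P ^ (m + n) := by
  set L : ℝ := 2 * (n + 2) with hL
  have hL0 : 0 < L := by positivity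
  have hL1 : 1 ≤ L := by
    have : (0 : ℝ) ≤ n := n.cast_nonneg
    linarith
  set K : ℝ := (m + n + 1).factorial * (2 ^ m) ^ (m + n) * max 1 |ξ| ^ (m + n) with hK
  have hK0 : 0 < K := by positivity
  have hdecay : Tendsto (fun H : ℝ => K * L ^ (m + n) * H ^ (-(w - (m + n : ℕ)))) atTop
      (nhds (K * L ^ (m + n) * 0)) :=
    (tendsto_rpow_neg_atTop (sub_pos.mpr hw)).const_mul _
  rw [mul_zero] at hdecay
  obtain ⟨H₀, hH₀⟩ := eventually_atTop.mp
    ((hunif.and (hdecay.eventually_le_const (show (0 : ℝ) < 1 / 2 by norm_num))).and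
      (eventually_gt_atTop 0))
  have hlarge : ∀ P : ℤ[X], Irreducible P → P.natDegree ≤ m → L * H₀ ≤ intMahlerMeasure P →
      1 / (2 * K) ≤ |aeval ξ P| * intMahlerMeasure P ^ (m + n) := by
    intro P hP hPm hPM
    set M := intMahlerMeasure P
    have hM1 : 1 ≤ M := one_le_intMahlerMeasure hP.ne_zero
    have hHM : H₀ ≤ M / L := by
      rw [le_div_iff₀ hL0]
      linarith
    obtain ⟨⟨⟨Q, hQn, hQH, hQ0, hQw⟩, hsmall⟩, hpos⟩ := hH₀ _ hHM
    have hQne : Q ≠ 0 := by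
      rintro rfl
      simp at hQ0
    have hPQ : ¬ P ∣ Q := by
      intro hdvd
      have h1 : M ≤ intMahlerMeasure Q := intMahlerMeasure_le_of_dvd hdvd hQne
      have h2 := intMahlerMeasure_le_polyHeight hQn
      have h3 : ((n + 1 : ℕ) + 1 : ℝ) * polyHeight Q ≤ ((n + 1 : ℕ) + 1 : ℝ) * (M / L) :=
        mul_le_mul_of_nonneg_left hQH (by positivity)
      have h4 : ((n + 1 : ℕ) + 1 : ℝ) * (M / L) = M / 2 := by
        rw [hL]
        push_cast
        field_simp
        ring
      linarith
    have h2m : (1 : ℝ) ≤ 2 ^ m := one_le_pow₀ (by norm_num)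
    have hMB : M ≤ 2 ^ m * M := le_mul_of_one_le_left (by linarith) h2m
    have hone := one_le_of_irreducible_of_not_dvd (ξ := ξ) (B := 2 ^ m * M) hP hPQ hPm hQn
      (hM1.trans hMB)
      (fun i => (abs_coeff_le_two_pow_mul_intMahlerMeasure P i).trans (by
        refine mul_le_mul_of_nonneg_right ?_ (by linarith)
        exact pow_le_pow_right₀ (by norm_num) hPm))
      (fun i => (abs_coeff_le_polyHeight Q i).trans
        (hQH.trans ((div_le_self (by linarith) hL1).trans hMB)))
    have hQsmall : K * M ^ (m + n) * |aeval ξ Q| ≤ 1 / 2 := by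
      refine le_trans ?_ hsmall
      have h1 : M ^ (m + n) = L ^ (m + n) * (M / L) ^ (m + n) := by
        rw [← mul_pow, mul_div_cancel₀ _ hL0.ne']
      have h2 : (M / L) ^ (-(w - (m + n : ℕ))) = (M / L) ^ (m + n) * (M / L) ^ (-w) := by
        rw [← Real.rpow_natCast, ← Real.rpow_add hpos]
        congr 1
        ring
      rw [h1, h2]
      calc _ ≤ K * (L ^ (m + n) * (M / L) ^ (m + n)) * (M / L) ^ (-w) := by gcongr
        _ = _ := by ring
    have hsplit : 1 ≤ K * M ^ (m + n) * |aeval ξ P| + K * M ^ (m + n) * |aeval ξ Q| := by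
      refine hone.trans_eq ?_
      rw [hK, mul_pow]
      ring
    rw [div_le_iff₀ (by positivity)]
    linarith
  have hfin := finite_intMahlerMeasure_le m (L * H₀)
  have hsmall : ∀ᶠ c : ℝ in nhdsWithin 0 (Set.Ioi 0),
      ∀ P ∈ {P : ℤ[X] | P.natDegree ≤ m ∧ intMahlerMeasure P ≤ L * H₀}, P ≠ 0 →
        c ≤ |aeval ξ P| * intMahlerMeasure P ^ (m + n) := by
    rw [eventually_all_finite hfin]
    intro P _
    by_cases hP : P = 0
    · simp [hP]
    · have h : 0 < |aeval ξ P| * intMahlerMeasure P ^ (m + n) :=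
        mul_pos (abs_pos.mpr (hξ P hP)) (pow_pos (by linarith [one_le_intMahlerMeasure hP]) _)
      filter_upwards [nhdsWithin_le_nhds (eventually_le_nhds h)] with c hc _ using hc
  have hle : ∀ r : ℝ, 0 < r → ∀ᶠ c : ℝ in nhdsWithin 0 (Set.Ioi 0), c ≤ r := fun r hr =>
    nhdsWithin_le_nhds (eventually_le_nhds hr)
  obtain ⟨c, ⟨⟨hc0, hcK⟩, hc1⟩, hcs⟩ := (((eventually_mem_nhdsWithin.and
    (hle (1 / (2 * K)) (by positivity))).and (hle 1 one_pos)).and hsmall).exists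
  refine ⟨c, hc0, hc1, fun P hP hPm => ?_⟩
  rcases le_total (intMahlerMeasure P) (L * H₀) with h | h
  · exact hcs P ⟨hPm, h⟩ hP.ne_zero
  · exact hcK.trans (hlarge P hP hPm h)

theorem one_le_abs_aeval_of_natDegree_eq_zero {P : ℤ[X]} (hP : P ≠ 0) (h : P.natDegree = 0)
    (ξ : ℝ) : 1 ≤ |aeval ξ P| := by
  rw [eq_C_of_natDegree_eq_zero h] at hP ⊢
  have h0 : P.coeff 0 ≠ 0 := by simpa using hP
  simpa using (show (1 : ℝ) ≤ |(P.coeff 0 : ℝ)| by exact_mod_cast Int.one_le_abs h0)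

/-- The lower bound for irreducible polynomials extends multiplicatively. -/
theorem pow_natDegree_le_of_irreducible {ξ c : ℝ} {m k : ℕ} (hc0 : 0 < c) (hc1 : c ≤ 1)
    (hc : ∀ P : ℤ[X], Irreducible P → P.natDegree ≤ m →
      c ≤ |aeval ξ P| * intMahlerMeasure P ^ k) (P : ℤ[X]) :
    P ≠ 0 → P.natDegree ≤ m → c ^ P.natDegree ≤ |aeval ξ P| * intMahlerMeasure P ^ k := by
  have hconst : ∀ P : ℤ[X], P ≠ 0 → P.natDegree = 0 →
      c ^ P.natDegree ≤ |aeval ξ P| * intMahlerMeasure P ^ k := by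
    intro P hP h
    rw [h, pow_zero]
    exact one_le_mul_of_one_le_of_one_le (one_le_abs_aeval_of_natDegree_eq_zero hP h ξ)
      (one_le_pow₀ (one_le_intMahlerMeasure hP))
  induction P using UniqueFactorizationMonoid.induction_on_prime with
  | h₁ => exact fun h => absurd rfl h
  | h₂ P hP => exact fun h _ => hconst P h (natDegree_eq_zero_of_isUnit hP)
  | h₃ A P hA hP ih =>
    intro _ hdeg
    rw [natDegree_mul hP.ne_zero hA] at hdeg ⊢
    rw [map_mul, abs_mul, intMahlerMeasure_mul, mul_pow, pow_add, mul_mul_mul_comm]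
    refine mul_le_mul ?_ (ih hA (by omega)) (by positivity)
      (mul_nonneg (abs_nonneg _) (pow_nonneg (mahlerMeasure_nonneg _) _))
    by_cases h0 : P.natDegree = 0
    · exact hconst P hP.ne_zero h0
    · exact (pow_le_of_le_one hc0.le hc1 h0).trans (hc P hP.irreducible (by omega))

/-- If the uniform exponent in degree `n + 1` exceeds `m + n`, then `w_m(ξ) ≤ m + n`. -/
theorem wExp_le_of_lt_uniform {ξ : ℝ} (hξ : ∀ P : ℤ[X], P ≠ 0 → aeval ξ P ≠ 0)
    {m n : ℕ} {w : ℝ} (hw : ((m + n : ℕ) : ℝ) < w)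
    (hunif : ∀ᶠ H : ℝ in atTop, ∃ P : ℤ[X], P.natDegree ≤ n + 1 ∧ polyHeight P ≤ H ∧
      0 < |aeval ξ P| ∧ |aeval ξ P| ≤ H ^ (-w)) :
    wExp m ξ ≤ (((m + n : ℕ) : ℝ) : EReal) := by
  obtain ⟨c, hc0, hc1, hc⟩ := exists_lower_bound_of_irreducible hξ hw hunif
  refine sSup_le ?_
  rintro _ ⟨v, rfl, hinf⟩
  rw [EReal.coe_le_coe_iff]
  by_contra! hv
  have hdecay : Tendsto (fun H : ℝ => (m + 1 : ℝ) ^ (m + n) * H ^ (-(v - (m + n : ℕ)))) atTop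
      (nhds ((m + 1 : ℝ) ^ (m + n) * 0)) :=
    (tendsto_rpow_neg_atTop (sub_pos.mpr hv)).const_mul _
  rw [mul_zero] at hdecay
  obtain ⟨H₀, hH₀⟩ := eventually_atTop.mp
    (hdecay.eventually_lt_const (show (0 : ℝ) < c ^ m by positivity))
  refine hinf ((finite_intMahlerMeasure_le m ((m + 1) * H₀)).subset ?_)
  rintro P ⟨hPm, hP0, hPv⟩
  have hP : P ≠ 0 := by
    rintro rfl
    simp at hP0
  have hH1 := one_le_polyHeight hP
  have hMH := intMahlerMeasure_le_polyHeight hPm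
  have hM1 := one_le_intMahlerMeasure hP
  refine ⟨hPm, hMH.trans ?_⟩
  by_contra! hlt
  have hHH : H₀ ≤ polyHeight P := (lt_of_mul_lt_mul_left hlt (by positivity)).le
  have hlow := pow_natDegree_le_of_irreducible hc0 hc1 hc P hP hPm
  have hlow' : c ^ m ≤ c ^ P.natDegree := pow_le_pow_of_le_one hc0.le hc1 hPm
  have hup : |aeval ξ P| * intMahlerMeasure P ^ (m + n) ≤
      (m + 1 : ℝ) ^ (m + n) * polyHeight P ^ (-(v - (m + n : ℕ))) := by
    have h2 : polyHeight P ^ (-(v - (m + n : ℕ))) =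
        polyHeight P ^ (m + n) * polyHeight P ^ (-v) := by
      rw [← Real.rpow_natCast, ← Real.rpow_add (by linarith)]
      congr 1
      ring
    calc _ ≤ polyHeight P ^ (-v) * ((m + 1) * polyHeight P) ^ (m + n) := by gcongr
      _ = _ := by
        rw [h2, mul_pow]
        ring
  linarith [hH₀ _ hHH]

theorem stmt13 (ξ : ℝ) (hξ : Transcendental ℚ ξ)
    (hext : wExp 2 ξ = ((2 + Real.sqrt 5 : ℝ) : EReal)) :
    whExp 3 ξ ≤ (4 : EReal) := by
  refine sSup_le ?_
  rintro _ ⟨w, rfl, hunif⟩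
  by_contra! hw
  have hne : ∀ P : ℤ[X], P ≠ 0 → aeval ξ P ≠ 0 := by
    intro P hP h
    exact hξ ((IsFractionRing.isAlgebraic_iff ℤ ℚ ℝ).mp ⟨P, hP, h⟩)
  have hw' : (((2 + 2 : ℕ)) : ℝ) < w := by
    norm_num
    exact EReal.coe_lt_coe_iff.mp hw
  have h := wExp_le_of_lt_uniform hne hw' hunif
  rw [hext, EReal.coe_le_coe_iff] at h
  have h5 : (2 : ℝ) < √5 := Real.lt_sqrt_of_sq_lt (by norm_num)
  norm_num at h
  linarith
end

section
/- For every integer n ≥ 2 and every transcendental real number ξ, ŵ_n(ξ) ≤ (2(w*_n(ξ) + n) - 1)/3. -/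
open Polynomial Filter

/-- The product of `max p q` over all pairs `(p, q)` from two multisets. -/
noncomputable def maxProd (s t : Multiset ℝ) : ℝ :=
  (s.map fun p => (t.map fun q => max p q).prod).prod

theorem maxProd_nonneg {s t : Multiset ℝ} (hs : ∀ p ∈ s, 0 ≤ p) : 0 ≤ maxProd s t := by
  refine Multiset.prod_nonneg fun x hx => ?_
  obtain ⟨p, hp, rfl⟩ := Multiset.mem_map.1 hx
  refine Multiset.prod_nonneg fun y hy => ?_
  obtain ⟨q, -, rfl⟩ := Multiset.mem_map.1 hy
  exact (hs p hp).trans (le_max_left _ _)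

theorem maxProd_cons (p : ℝ) (s t : Multiset ℝ) :
    maxProd (p ::ₘ s) t = (t.map fun q => max p q).prod * maxProd s t := by
  simp [maxProd]

theorem prod_map_max_le_one {p : ℝ} {t : Multiset ℝ} (hp0 : 0 ≤ p) (hp : p ≤ 1)
    (ht : ∀ q ∈ t, q ≤ 1) : (t.map fun q => max p q).prod ≤ 1 := by
  have := Multiset.prod_map_le_prod_map₀ (s := t) (fun q => max p q) (fun _ => (1 : ℝ))
    (fun q _ => hp0.trans (le_max_left _ _)) (fun q hq => max_le hp (ht q hq))
  simpa using this

theorem prod_map_max_of_le {p : ℝ} {t : Multiset ℝ} (h : ∀ q ∈ t, p ≤ q) :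
    (t.map fun q => max p q).prod = t.prod := by
  rw [Multiset.map_congr rfl fun q hq => max_eq_right (h q hq), Multiset.map_id']

theorem maxProd_le_prod {s t : Multiset ℝ} {g : ℝ → ℝ} (hs : ∀ p ∈ s, 0 ≤ p)
    (h : ∀ p ∈ s, (t.map fun q => max p q).prod ≤ g p) : maxProd s t ≤ (s.map g).prod := by
  refine Multiset.prod_map_le_prod_map₀ _ _ (fun p hp => ?_) h
  refine Multiset.prod_nonneg fun y hy => ?_
  obtain ⟨q, -, rfl⟩ := Multiset.mem_map.1 hy
  exact (hs p hp).trans (le_max_left _ _)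

/-- Upper bounds for `∏ max p q` in terms of `∏ p` and `∏ q`, according to the relative position
of the two smallest elements of each multiset. -/
theorem maxProd_bounds {p₁ p₂ q₁ q₂ : ℝ} {s t : Multiset ℝ}
    (hs0 : ∀ p ∈ p₁ ::ₘ p₂ ::ₘ s, 0 ≤ p) (hs1 : ∀ p ∈ p₁ ::ₘ p₂ ::ₘ s, p ≤ 1)
    (ht0 : ∀ q ∈ q₁ ::ₘ q₂ ::ₘ t, 0 ≤ q) (ht1 : ∀ q ∈ q₁ ::ₘ q₂ ::ₘ t, q ≤ 1)
    (hps : ∀ p ∈ s, p₂ ≤ p) (hq : q₁ ≤ q₂) (hqt : ∀ q ∈ t, q₂ ≤ q)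
    (hpq : p₁ ≤ q₁) :
    (p₂ ≤ q₁ ∧ maxProd (p₁ ::ₘ p₂ ::ₘ s) (q₁ ::ₘ q₂ ::ₘ t) ≤ (q₁ ::ₘ q₂ ::ₘ t).prod ^ 2) ∨
    (q₁ < p₂ ∧ (maxProd (p₁ ::ₘ p₂ ::ₘ s) (q₁ ::ₘ q₂ ::ₘ t) * p₁ ^ 2 ≤
        (q₁ ::ₘ q₂ ::ₘ t).prod ^ 2 * (p₁ ::ₘ p₂ ::ₘ s).prod ∨
      maxProd (p₁ ::ₘ p₂ ::ₘ s) (q₁ ::ₘ q₂ ::ₘ t) * p₁ ^ 2 ≤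
        (q₁ ::ₘ q₂ ::ₘ t).prod * (p₁ ::ₘ p₂ ::ₘ s).prod ^ 2)) := by
  have hp₁0 : 0 ≤ p₁ := hs0 _ (by simp)
  have hp₂0 : 0 ≤ p₂ := hs0 _ (by simp)
  have hq₁0 : 0 ≤ q₁ := ht0 _ (by simp)
  have hq₂0 : 0 ≤ q₂ := ht0 _ (by simp)
  have hp₂1 : p₂ ≤ 1 := hs1 _ (by simp)
  have hs0' : ∀ p ∈ s, 0 ≤ p := fun p h => hs0 p (by simp [h])
  have ht0' : ∀ q ∈ t, 0 ≤ q := fun q h => ht0 q (by simp [h])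
  have hsP : 0 ≤ s.prod := Multiset.prod_nonneg hs0'
  have htP : 0 ≤ t.prod := Multiset.prod_nonneg ht0'
  have ht1' : ∀ q ∈ t, q ≤ 1 := fun q h => ht1 q (by simp [h])
  have hR₁ : ((q₁ ::ₘ q₂ ::ₘ t).map fun q => max p₁ q).prod = (q₁ ::ₘ q₂ ::ₘ t).prod := by
    refine prod_map_max_of_le fun q h => ?_
    rcases Multiset.mem_cons.1 h with rfl | h
    · exact hpq
    rcases Multiset.mem_cons.1 h with rfl | h
    · exact hpq.trans hq
    · exact hpq.trans (hq.trans (hqt q h))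
  have hT : (q₁ ::ₘ q₂ ::ₘ t).prod = q₁ * (q₂ * t.prod) := by simp
  have hS : (p₁ ::ₘ p₂ ::ₘ s).prod = p₁ * (p₂ * s.prod) := by simp
  rw [maxProd_cons, maxProd_cons, hR₁]
  rcases le_or_gt p₂ q₁ with h | h
  · refine Or.inl ⟨h, ?_⟩
    have hR₂ : ((q₁ ::ₘ q₂ ::ₘ t).map fun q => max p₂ q).prod = (q₁ ::ₘ q₂ ::ₘ t).prod := by
      refine prod_map_max_of_le fun q h' => ?_
      rcases Multiset.mem_cons.1 h' with rfl | h'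
      · exact h
      rcases Multiset.mem_cons.1 h' with rfl | h'
      · exact h.trans hq
      · exact h.trans (hq.trans (hqt q h'))
    rw [hR₂]
    have hrest : maxProd s (q₁ ::ₘ q₂ ::ₘ t) ≤ 1 := by
      refine (maxProd_le_prod (g := fun _ => 1) hs0' fun p hp' => ?_).trans (by simp)
      exact prod_map_max_le_one (hs0' p hp') (hs1 p (by simp [hp'])) ht1
    have hTn : 0 ≤ (q₁ ::ₘ q₂ ::ₘ t).prod := Multiset.prod_nonneg ht0
    nlinarith [mul_le_mul_of_nonneg_left hrest (mul_nonneg hTn hTn)]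
  · refine Or.inr ⟨h, ?_⟩
    rcases le_or_gt p₂ q₂ with h' | h'
    · left
      have hR₂ : ((q₁ ::ₘ q₂ ::ₘ t).map fun q => max p₂ q).prod = p₂ * (q₂ * t.prod) := by
        rw [Multiset.map_cons, Multiset.prod_cons, max_eq_left h.le, prod_map_max_of_le,
          Multiset.prod_cons]
        intro q hq'
        rcases Multiset.mem_cons.1 hq' with rfl | hq'
        · exact h'
        · exact h'.trans (hqt q hq')
      have hrest : maxProd s (q₁ ::ₘ q₂ ::ₘ t) ≤ s.prod := by
        refine (maxProd_le_prod (g := id) hs0' fun p hp' => ?_).trans (by simp)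
        rw [Multiset.map_cons, Multiset.prod_cons, max_eq_left (h.le.trans (hps p hp'))]
        refine mul_le_of_le_one_right (hs0' p hp') ?_
        exact prod_map_max_le_one (hs0' p hp') (hs1 p (by simp [hp']))
          fun q hq' => ht1 q (Multiset.mem_cons_of_mem hq')
      rw [hR₂, hT, hS]
      calc q₁ * (q₂ * t.prod) * (p₂ * (q₂ * t.prod) * maxProd s (q₁ ::ₘ q₂ ::ₘ t)) * p₁ ^ 2
          ≤ q₁ * (q₂ * t.prod) * (p₂ * (q₂ * t.prod) * s.prod) * (p₁ * q₁) := by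
            have := maxProd_nonneg (t := q₁ ::ₘ q₂ ::ₘ t) hs0'
            rw [sq]
            gcongr
        _ = _ := by ring
    · right
      have key : ∀ p, 0 ≤ p → p ≤ 1 → p₂ ≤ p →
          ((q₁ ::ₘ q₂ ::ₘ t).map fun q => max p q).prod ≤ p * p := by
        intro p hp0 hp1 hp2
        rw [Multiset.map_cons, Multiset.prod_cons, Multiset.map_cons, Multiset.prod_cons,
          max_eq_left (h.le.trans hp2), max_eq_left (h'.le.trans hp2)]
        refine mul_le_mul_of_nonneg_left ?_ hp0
        exact mul_le_of_le_one_right hp0 (prod_map_max_le_one hp0 hp1 ht1')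
      have hrest : maxProd s (q₁ ::ₘ q₂ ::ₘ t) ≤ s.prod * s.prod := by
        refine (maxProd_le_prod (g := fun p => p * p) hs0' fun p hp' => ?_).trans ?_
        · exact key p (hs0' p hp') (hs1 p (by simp [hp'])) (hps p hp')
        · rw [Multiset.prod_map_mul]; simp
      have hR₂ := key p₂ hp₂0 hp₂1 le_rfl
      rw [hT, hS]
      calc q₁ * (q₂ * t.prod) * (((q₁ ::ₘ q₂ ::ₘ t).map fun q => max p₂ q).prod *
            maxProd s (q₁ ::ₘ q₂ ::ₘ t)) * p₁ ^ 2
          ≤ q₁ * (q₂ * t.prod) * ((p₂ * p₂) * (s.prod * s.prod)) * p₁ ^ 2 := by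
            have := maxProd_nonneg (t := q₁ ::ₘ q₂ ::ₘ t) hs0'
            gcongr
        _ = _ := by ring

/-- The two smallest elements of a multiset. -/
theorem exists_cons_cons_of_two_le_card {s : Multiset ℝ} (h : 2 ≤ Multiset.card s) :
    ∃ p₁ p₂ s', s = p₁ ::ₘ p₂ ::ₘ s' ∧ p₁ ≤ p₂ ∧ ∀ p ∈ s', p₂ ≤ p := by
  have h0 : s ≠ 0 := by rintro rfl; simp at h
  obtain ⟨p₁, hp₁, h₁⟩ := Multiset.exists_min_image id h0
  obtain ⟨u, rfl⟩ := Multiset.exists_cons_of_mem hp₁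
  have hu : u ≠ 0 := by rintro rfl; simp at h
  obtain ⟨p₂, hp₂, h₂⟩ := Multiset.exists_min_image id hu
  obtain ⟨v, rfl⟩ := Multiset.exists_cons_of_mem hp₂
  exact ⟨p₁, p₂, v, rfl, h₁ p₂ (by simp), fun p hp => h₂ p (by simp [hp])⟩

/-- The distances from `ξ` to the complex roots of `P`, truncated at `1`. -/
noncomputable def rootDist (ξ : ℝ) (P : ℂ[X]) : Multiset ℝ :=
  P.roots.map fun α => min 1 ‖(ξ : ℂ) - α‖

/-- The analogue of the Mahler measure with the origin moved to `ξ`. -/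
noncomputable def shiftedMeasure (ξ : ℝ) (P : ℂ[X]) : ℝ :=
  ‖P.leadingCoeff‖ * (P.roots.map fun α => max 1 ‖(ξ : ℂ) - α‖).prod

theorem max_one_mul_min_one (x : ℝ) : max 1 x * min 1 x = x := by
  rw [max_mul_min, one_mul]

theorem norm_eval_eq_prod_roots (P : ℂ[X]) (z : ℂ) :
    ‖P.eval z‖ = ‖P.leadingCoeff‖ * (P.roots.map fun α => ‖z - α‖).prod := by
  conv_lhs => rw [(IsAlgClosed.splits P).eq_prod_roots]
  rw [eval_mul, eval_C, eval_multiset_prod, norm_mul, Multiset.map_map]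
  congr 1
  induction P.roots using Multiset.induction_on with
  | empty => simp
  | cons a s ih => simp [← ih]

theorem norm_eval_eq_shiftedMeasure_mul (ξ : ℝ) (P : ℂ[X]) :
    ‖P.eval (ξ : ℂ)‖ = shiftedMeasure ξ P * (rootDist ξ P).prod := by
  rw [norm_eval_eq_prod_roots, shiftedMeasure, rootDist, mul_assoc, ← Multiset.prod_map_mul]
  simp only [max_one_mul_min_one]

theorem rootDist_mem {ξ x : ℝ} {P : ℂ[X]} (h : x ∈ rootDist ξ P) : 0 ≤ x ∧ x ≤ 1 := by
  obtain ⟨α, -, rfl⟩ := Multiset.mem_map.1 h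
  exact ⟨le_min zero_le_one (norm_nonneg _), min_le_left _ _⟩

theorem norm_sub_le_max_min (ξ : ℝ) (α β : ℂ) :
    ‖α - β‖ ≤ 2 * max 1 ‖(ξ : ℂ) - α‖ * max 1 ‖(ξ : ℂ) - β‖ *
      max (min 1 ‖(ξ : ℂ) - α‖) (min 1 ‖(ξ : ℂ) - β‖) := by
  have h : ‖α - β‖ ≤ ‖(ξ : ℂ) - α‖ + ‖(ξ : ℂ) - β‖ := by
    rw [show α - β = ((ξ : ℂ) - β) - ((ξ : ℂ) - α) by ring, add_comm]
    exact norm_sub_le _ _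
  refine h.trans ?_
  generalize hx : ‖(ξ : ℂ) - α‖ = x
  generalize hy : ‖(ξ : ℂ) - β‖ = y
  have hx0 : 0 ≤ x := hx ▸ norm_nonneg _
  have hy0 : 0 ≤ y := hy ▸ norm_nonneg _
  have h1 : x ≤ max 1 x * max 1 y * max (min 1 x) (min 1 y) :=
    calc x = max 1 x * 1 * min 1 x := by rw [mul_one, max_one_mul_min_one]
      _ ≤ _ := by gcongr <;> simp
  have h2 : y ≤ max 1 x * max 1 y * max (min 1 x) (min 1 y) :=
    calc y = 1 * max 1 y * min 1 y := by rw [one_mul, max_one_mul_min_one]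
      _ ≤ _ := by gcongr <;> simp
  linarith

theorem leadingCoeff_le_shiftedMeasure (ξ : ℝ) (P : ℂ[X]) :
    ‖P.leadingCoeff‖ ≤ shiftedMeasure ξ P := by
  refine le_mul_of_one_le_right (norm_nonneg _) ?_
  have := Multiset.prod_map_le_prod_map₀ (s := P.roots) (fun _ => (1 : ℝ))
    (fun α => max 1 ‖(ξ : ℂ) - α‖) (by simp) (by simp)
  simpa using this

theorem shiftedMeasure_le (ξ : ℝ) (P : ℂ[X]) {n : ℕ} (hn : P.natDegree ≤ n) :
    shiftedMeasure ξ P ≤ (1 + |ξ|) ^ n * P.mahlerMeasure := by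
  rw [mahlerMeasure_eq_leadingCoeff_mul_prod_roots, shiftedMeasure, mul_left_comm]
  refine mul_le_mul_of_nonneg_left ?_ (norm_nonneg _)
  have h1 : (P.roots.map fun α => max 1 ‖(ξ : ℂ) - α‖).prod ≤
      (P.roots.map fun α => (1 + |ξ|) * max 1 ‖α‖).prod := by
    refine Multiset.prod_map_le_prod_map₀ _ _ (fun _ _ => by positivity) fun α _ => ?_
    have h2 : ‖(ξ : ℂ) - α‖ ≤ |ξ| + ‖α‖ := (norm_sub_le _ _).trans (by simp)
    have h3 := le_max_left 1 ‖α‖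
    have h4 := le_max_right 1 ‖α‖
    refine max_le ?_ ?_ <;> nlinarith [abs_nonneg ξ]
  refine h1.trans ?_
  rw [Multiset.prod_map_mul, Multiset.map_const', Multiset.prod_replicate]
  refine mul_le_mul_of_nonneg_right ?_ (zero_le_one.trans (one_le_prod_max_one_norm_roots P))
  refine pow_le_pow_right₀ (by simp) ?_
  exact (card_roots' P).trans hn

theorem norm_resultant_le (ξ : ℝ) (P Q : ℂ[X]) :
    ‖P.resultant Q‖ ≤ 2 ^ (P.natDegree * Q.natDegree) * shiftedMeasure ξ P ^ Q.natDegree *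
      shiftedMeasure ξ Q ^ P.natDegree * maxProd (rootDist ξ P) (rootDist ξ Q) := by
  have hcP : Multiset.card P.roots = P.natDegree :=
    (splits_iff_card_roots.1 (IsAlgClosed.splits P))
  have hcQ : Multiset.card Q.roots = Q.natDegree :=
    (splits_iff_card_roots.1 (IsAlgClosed.splits Q))
  rw [resultant_eq_prod_eval _ _ _ le_rfl (IsAlgClosed.splits P), norm_mul, norm_pow]
  have h0 : ‖(P.roots.map fun α => Q.eval α).prod‖ = (P.roots.map fun α => ‖Q.eval α‖).prod := by
    induction P.roots using Multiset.induction_on with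
    | empty => simp
    | cons a s ih => simp [← ih]
  have h1 : ∀ α : ℂ, ‖Q.eval α‖ ≤ shiftedMeasure ξ Q * 2 ^ Q.natDegree *
      max 1 ‖(ξ : ℂ) - α‖ ^ Q.natDegree *
        ((rootDist ξ Q).map fun q => max (min 1 ‖(ξ : ℂ) - α‖) q).prod := by
    intro α
    rw [norm_eval_eq_prod_roots, shiftedMeasure]
    have : (Q.roots.map fun β => ‖α - β‖).prod ≤ (Q.roots.map fun β =>
        2 * max 1 ‖(ξ : ℂ) - α‖ * max 1 ‖(ξ : ℂ) - β‖ *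
          max (min 1 ‖(ξ : ℂ) - α‖) (min 1 ‖(ξ : ℂ) - β‖)).prod :=
      Multiset.prod_map_le_prod_map₀ _ _ (fun _ _ => norm_nonneg _)
        fun β _ => norm_sub_le_max_min ξ α β
    rw [Multiset.prod_map_mul, Multiset.prod_map_mul, Multiset.map_const',
      Multiset.prod_replicate, hcQ, mul_pow] at this
    rw [rootDist, Multiset.map_map]
    refine (mul_le_mul_of_nonneg_left this (norm_nonneg _)).trans (le_of_eq ?_)
    simp only [Function.comp_def]
    ring
  have h2 := Multiset.prod_map_le_prod_map₀ (s := P.roots) (fun α => ‖Q.eval α‖) _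
    (fun _ _ => norm_nonneg _) fun α _ => h1 α
  rw [Multiset.prod_map_mul, Multiset.prod_map_mul, Multiset.map_const',
      Multiset.prod_replicate, hcP, Multiset.prod_map_pow] at h2
  rw [h0]
  refine (mul_le_mul_of_nonneg_left h2 (by positivity)).trans (le_of_eq ?_)
  rw [maxProd, rootDist, rootDist, Multiset.map_map, shiftedMeasure, shiftedMeasure]
  simp only [Function.comp_def]
  ring

theorem maxProd_pad {s t : Multiset ℝ} (hs : ∀ p ∈ s, p ≤ 1) (ht : ∀ q ∈ t, q ≤ 1) :
    maxProd (1 ::ₘ 1 ::ₘ s) (1 ::ₘ 1 ::ₘ t) = maxProd s t := by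
  have h : ∀ u : Multiset ℝ, (∀ q ∈ u, q ≤ 1) → (u.map fun q => max 1 q).prod = 1 := by
    intro u hu
    rw [Multiset.map_congr rfl fun q hq => max_eq_left (hu q hq)]
    simp
  rw [maxProd_cons, maxProd_cons, h _ (by simpa using ht), one_mul, one_mul]
  unfold maxProd
  congr 1
  refine Multiset.map_congr rfl fun p hp => ?_
  simp [hs p hp]

theorem exists_real_root_of_gap {ξ p₁ p₂ : ℝ} {P : ℤ[X]} {s : Multiset ℝ}
    (hs : 1 ::ₘ 1 ::ₘ rootDist ξ (P.map (Int.castRingHom ℂ)) = p₁ ::ₘ p₂ ::ₘ s)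
    (h12 : p₁ < p₂) (h2 : ∀ p ∈ s, p₂ ≤ p) (h1 : p₁ < 1) :
    ∃ α : ℝ, aeval α P = 0 ∧ |ξ - α| = p₁ := by
  have hmem : p₁ ∈ rootDist ξ (P.map (Int.castRingHom ℂ)) := by
    have : p₁ ∈ 1 ::ₘ 1 ::ₘ rootDist ξ (P.map (Int.castRingHom ℂ)) := by rw [hs]; simp
    simpa [h1.ne] using this
  obtain ⟨α, hα, hp⟩ := Multiset.mem_map.1 hmem
  have hp' : ‖(ξ : ℂ) - α‖ = p₁ := by
    rcases min_choice 1 ‖(ξ : ℂ) - α‖ with h | h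
    · rw [h] at hp; exact absurd hp h1.ne'
    · rw [← h, hp]
  have hα0 : aeval α P = 0 := (mem_aroots'.1 hα).2
  by_cases him : α.im = 0
  · have hre : ((α.re : ℝ) : ℂ) = α := Complex.ext rfl (by simp [him])
    refine ⟨α.re, ?_, ?_⟩
    · have : ((aeval α.re P : ℝ) : ℂ) = 0 := by
        rw [← Complex.coe_algebraMap, ← aeval_algebraMap_apply, Complex.coe_algebraMap, hre, hα0]
      exact_mod_cast this
    · rw [← hp', ← hre, ← Complex.ofReal_sub, Complex.norm_real]; simp
  · exfalso
    set β := (starRingEnd ℂ) α with hβ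
    have hne : β ≠ α := fun h => him (Complex.conj_eq_iff_im.1 h)
    have hβ0 : aeval β P = 0 := by
      have := aeval_algHom_apply (Complex.conjAe.toAlgHom.restrictScalars ℤ) α P
      simpa [hα0] using this
    have hβm : β ∈ (P.map (Int.castRingHom ℂ)).roots :=
      mem_aroots'.2 ⟨(mem_aroots'.1 hα).1, hβ0⟩
    have hβp : min 1 ‖(ξ : ℂ) - β‖ = p₁ := by
      have : (ξ : ℂ) - β = (starRingEnd ℂ) ((ξ : ℂ) - α) := by simp [hβ]
      rw [this, RCLike.norm_conj, hp]
    obtain ⟨u, hu⟩ := Multiset.exists_cons_of_mem hα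
    have hβu : β ∈ u := by
      rw [hu] at hβm
      exact (Multiset.mem_cons.1 hβm).resolve_left hne
    obtain ⟨v, hv⟩ := Multiset.exists_cons_of_mem hβu
    have hcount : Multiset.count p₁ (p₁ ::ₘ p₂ ::ₘ s) = 1 := by
      rw [Multiset.count_cons_self, Multiset.count_eq_zero_of_notMem]
      intro h
      rcases Multiset.mem_cons.1 h with h | h
      · exact h12.ne h
      · exact h12.not_ge (h2 _ h)
    rw [← hs, rootDist, hu, hv, Multiset.map_cons, Multiset.map_cons, hp, hβp] at hcount
    simp [h1.ne] at hcount

theorem one_le_norm_resultant {P Q : ℤ[X]} (h : P.resultant Q ≠ 0) :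
    1 ≤ ‖(P.map (Int.castRingHom ℂ)).resultant (Q.map (Int.castRingHom ℂ))‖ := by
  rw [natDegree_map_eq_of_injective Int.cast_injective,
    natDegree_map_eq_of_injective Int.cast_injective, resultant_map_map]
  have := Int.one_le_abs h
  simp only [eq_intCast, Complex.norm_intCast]
  exact_mod_cast this

theorem one_le_shiftedMeasure (ξ : ℝ) {P : ℤ[X]} (hP : P ≠ 0) :
    1 ≤ shiftedMeasure ξ (P.map (Int.castRingHom ℂ)) := by
  refine le_trans ?_ (leadingCoeff_le_shiftedMeasure ξ _)
  rw [leadingCoeff_map_of_injective (Int.castRingHom ℂ).injective_int]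
  have := Int.one_le_abs (leadingCoeff_ne_zero.2 hP)
  simp only [eq_intCast, Complex.norm_intCast]
  exact_mod_cast this

theorem abs_aeval_eq (ξ : ℝ) (P : ℤ[X]) :
    |aeval ξ P| = shiftedMeasure ξ (P.map (Int.castRingHom ℂ)) *
      (rootDist ξ (P.map (Int.castRingHom ℂ))).prod := by
  rw [← norm_eval_eq_shiftedMeasure_mul, ← Real.norm_eq_abs, ← Complex.norm_real,
    ← Complex.coe_algebraMap, ← aeval_algebraMap_apply, Complex.coe_algebraMap, eval_map,
    ← algebraMap_int_eq, aeval_def]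

theorem one_le_mul_maxProd (ξ : ℝ) {P Q : ℤ[X]} {n : ℕ} (hP : P.natDegree ≤ n)
    (hQ : Q.natDegree ≤ n) (h : P.resultant Q ≠ 0) (hP0 : P ≠ 0) (hQ0 : Q ≠ 0) :
    1 ≤ 2 ^ (n * n) * shiftedMeasure ξ (P.map (Int.castRingHom ℂ)) ^ n *
      shiftedMeasure ξ (Q.map (Int.castRingHom ℂ)) ^ n *
        maxProd (1 ::ₘ 1 ::ₘ rootDist ξ (P.map (Int.castRingHom ℂ)))
          (1 ::ₘ 1 ::ₘ rootDist ξ (Q.map (Int.castRingHom ℂ))) := by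
  rw [maxProd_pad (fun p hp => (rootDist_mem hp).2) (fun p hp => (rootDist_mem hp).2)]
  have hA := one_le_shiftedMeasure ξ hP0
  have hB := one_le_shiftedMeasure ξ hQ0
  have hS := maxProd_nonneg (s := rootDist ξ (P.map (Int.castRingHom ℂ)))
    (t := rootDist ξ (Q.map (Int.castRingHom ℂ))) (fun p hp => (rootDist_mem hp).1)
  refine (one_le_norm_resultant h).trans ((norm_resultant_le ξ _ _).trans ?_)
  rw [natDegree_map_eq_of_injective Int.cast_injective,
    natDegree_map_eq_of_injective Int.cast_injective]
  gcongr
  · norm_num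

/-- Given two integer polynomials of degree at most `k + 2` without a common root, both small
at `ξ`, the one with the root closer to `ξ` has a real root very close to `ξ`. -/
theorem exists_real_root_aux {ξ μ Y p₁ p₂ q₁ q₂ : ℝ} {k : ℕ} {P Q : ℤ[X]} {s t : Multiset ℝ}
    (hP : P.natDegree ≤ k + 2) (hQ : Q.natDegree ≤ k + 2) (h : P.resultant Q ≠ 0)
    (hP0 : P ≠ 0) (hQ0 : Q ≠ 0)
    (hPX : shiftedMeasure ξ (P.map (Int.castRingHom ℂ)) ≤ μ)
    (hQX : shiftedMeasure ξ (Q.map (Int.castRingHom ℂ)) ≤ μ)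
    (hPY : |aeval ξ P| ≤ Y) (hQY : |aeval ξ Q| ≤ Y)
    (h₁ : 2 ^ ((k + 2) * (k + 2)) * μ ^ (2 * k + 2) * Y ^ 2 < 1)
    (h₂ : 2 ^ ((k + 2) * (k + 2)) * μ ^ (2 * k + 1) * Y ^ 3 < 1)
    (hs : 1 ::ₘ 1 ::ₘ rootDist ξ (P.map (Int.castRingHom ℂ)) = p₁ ::ₘ p₂ ::ₘ s)
    (ht : 1 ::ₘ 1 ::ₘ rootDist ξ (Q.map (Int.castRingHom ℂ)) = q₁ ::ₘ q₂ ::ₘ t)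
    (hps : ∀ p ∈ s, p₂ ≤ p) (hq : q₁ ≤ q₂) (hqt : ∀ q ∈ t, q₂ ≤ q) (hpq : p₁ ≤ q₁) :
    ∃ α : ℝ, aeval α P = 0 ∧
      |ξ - α| ^ 2 ≤ 2 ^ ((k + 2) * (k + 2)) * μ ^ (2 * k + 1) * Y ^ 3 := by
  have hs01 : ∀ p ∈ p₁ ::ₘ p₂ ::ₘ s, 0 ≤ p ∧ p ≤ 1 := by
    rw [← hs]
    intro p hp
    simp only [Multiset.mem_cons] at hp
    rcases hp with rfl | rfl | hp
    · simp
    · simp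
    · exact rootDist_mem hp
  have ht01 : ∀ p ∈ q₁ ::ₘ q₂ ::ₘ t, 0 ≤ p ∧ p ≤ 1 := by
    rw [← ht]
    intro p hp
    simp only [Multiset.mem_cons] at hp
    rcases hp with rfl | rfl | hp
    · simp
    · simp
    · exact rootDist_mem hp
  have hmain := one_le_mul_maxProd ξ hP hQ h hP0 hQ0
  have hA := one_le_shiftedMeasure ξ hP0
  have hB := one_le_shiftedMeasure ξ hQ0
  have hx := abs_aeval_eq ξ P
  have hy := abs_aeval_eq ξ Q
  have hsx : (rootDist ξ (P.map (Int.castRingHom ℂ))).prod = (p₁ ::ₘ p₂ ::ₘ s).prod := by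
    rw [← hs]; simp
  have hty : (rootDist ξ (Q.map (Int.castRingHom ℂ))).prod = (q₁ ::ₘ q₂ ::ₘ t).prod := by
    rw [← ht]; simp
  have hgap := exists_real_root_of_gap (ξ := ξ) (P := P) hs
  have hb := maxProd_bounds (fun p hp => (hs01 p hp).1) (fun p hp => (hs01 p hp).2)
    (fun p hp => (ht01 p hp).1) (fun p hp => (ht01 p hp).2) hps hq hqt hpq
  rw [hs, ht] at hmain
  rw [hsx] at hx
  rw [hty] at hy
  rw [hx] at hPY
  rw [hy] at hQY
  have hx0 : 0 ≤ (p₁ ::ₘ p₂ ::ₘ s).prod := Multiset.prod_nonneg fun p hp => (hs01 p hp).1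
  have hy0 : 0 ≤ (q₁ ::ₘ q₂ ::ₘ t).prod := Multiset.prod_nonneg fun p hp => (ht01 p hp).1
  have hp0 : 0 ≤ p₁ := (hs01 p₁ (by simp)).1
  generalize shiftedMeasure ξ (P.map (Int.castRingHom ℂ)) = A at *
  generalize shiftedMeasure ξ (Q.map (Int.castRingHom ℂ)) = B at *
  generalize maxProd (p₁ ::ₘ p₂ ::ₘ s) (q₁ ::ₘ q₂ ::ₘ t) = S at *
  generalize (p₁ ::ₘ p₂ ::ₘ s).prod = x at *
  generalize (q₁ ::ₘ q₂ ::ₘ t).prod = y at *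
  have hA0 : 0 ≤ A := zero_le_one.trans hA
  have hB0 : 0 ≤ B := zero_le_one.trans hB
  have hμ : 0 ≤ μ := hA0.trans hPX
  have hY : 0 ≤ Y := (mul_nonneg hA0 hx0).trans hPY
  have hAx := mul_nonneg hA0 hx0
  have hBy := mul_nonneg hB0 hy0
  set c : ℝ := 2 ^ ((k + 2) * (k + 2)) with hc
  have hc0 : 0 ≤ c := by positivity
  rcases hb with ⟨-, hb⟩ | ⟨hlt, hb⟩
  · exfalso
    refine absurd (hmain.trans ?_) h₁.not_ge
    calc c * A ^ (k + 2) * B ^ (k + 2) * S ≤ c * A ^ (k + 2) * B ^ (k + 2) * y ^ 2 := by gcongr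
      _ = c * (A ^ (k + 2) * B ^ k) * (B * y) ^ 2 := by ring
      _ ≤ c * (μ ^ (k + 2) * μ ^ k) * Y ^ 2 := by gcongr
      _ = _ := by ring
  · have hp : p₁ ^ 2 ≤ c * μ ^ (2 * k + 1) * Y ^ 3 := by
      have h0 : p₁ ^ 2 ≤ c * A ^ (k + 2) * B ^ (k + 2) * (S * p₁ ^ 2) := by
        have := mul_le_mul_of_nonneg_right hmain (sq_nonneg p₁)
        linarith
      refine h0.trans ?_
      rcases hb with hb | hb
      · calc c * A ^ (k + 2) * B ^ (k + 2) * (S * p₁ ^ 2)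
            ≤ c * A ^ (k + 2) * B ^ (k + 2) * (y ^ 2 * x) := by gcongr
          _ = c * (A ^ (k + 1) * B ^ k) * ((B * y) ^ 2 * (A * x)) := by ring
          _ ≤ c * (μ ^ (k + 1) * μ ^ k) * (Y ^ 2 * Y) := by gcongr
          _ = _ := by ring
      · calc c * A ^ (k + 2) * B ^ (k + 2) * (S * p₁ ^ 2)
            ≤ c * A ^ (k + 2) * B ^ (k + 2) * (y * x ^ 2) := by gcongr
          _ = c * (A ^ k * B ^ (k + 1)) * ((B * y) * (A * x) ^ 2) := by ring
          _ ≤ c * (μ ^ k * μ ^ (k + 1)) * (Y * Y ^ 2) := by gcongr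
          _ = _ := by ring
    have hp1 : p₁ < 1 := by
      by_contra! hge
      exact absurd (hp.trans_lt h₂) (by nlinarith)
    obtain ⟨α, hα, hα'⟩ := hgap (hpq.trans_lt hlt) hps hp1
    exact ⟨α, hα, by rw [hα']; exact hp⟩

theorem exists_real_root {ξ μ Y : ℝ} {k : ℕ} {P Q : ℤ[X]}
    (hP : P.natDegree ≤ k + 2) (hQ : Q.natDegree ≤ k + 2) (h : P.resultant Q ≠ 0)
    (hP0 : P ≠ 0) (hQ0 : Q ≠ 0)
    (hPX : shiftedMeasure ξ (P.map (Int.castRingHom ℂ)) ≤ μ)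
    (hQX : shiftedMeasure ξ (Q.map (Int.castRingHom ℂ)) ≤ μ)
    (hPY : |aeval ξ P| ≤ Y) (hQY : |aeval ξ Q| ≤ Y)
    (h₁ : 2 ^ ((k + 2) * (k + 2)) * μ ^ (2 * k + 2) * Y ^ 2 < 1)
    (h₂ : 2 ^ ((k + 2) * (k + 2)) * μ ^ (2 * k + 1) * Y ^ 3 < 1) :
    ∃ α : ℝ, (aeval α P = 0 ∨ aeval α Q = 0) ∧
      |ξ - α| ^ 2 ≤ 2 ^ ((k + 2) * (k + 2)) * μ ^ (2 * k + 1) * Y ^ 3 := by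
  obtain ⟨p₁, p₂, s, hs, hp, hps⟩ := exists_cons_cons_of_two_le_card
    (s := 1 ::ₘ 1 ::ₘ rootDist ξ (P.map (Int.castRingHom ℂ))) (by simp)
  obtain ⟨q₁, q₂, t, ht, hq, hqt⟩ := exists_cons_cons_of_two_le_card
    (s := 1 ::ₘ 1 ::ₘ rootDist ξ (Q.map (Int.castRingHom ℂ))) (by simp)
  rcases le_total p₁ q₁ with hpq | hpq
  · obtain ⟨α, hα, hα'⟩ := exists_real_root_aux hP hQ h hP0 hQ0 hPX hQX hPY hQY h₁ h₂ hs ht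
      hps hq hqt hpq
    exact ⟨α, Or.inl hα, hα'⟩
  · have h' : Q.resultant P ≠ 0 := by
      rw [resultant_comm]
      exact mul_ne_zero (pow_ne_zero _ (by norm_num)) h
    obtain ⟨α, hα, hα'⟩ := exists_real_root_aux hQ hP h' hQ0 hP0 hQX hPX hQY hPY h₁ h₂ ht hs
      hqt hp hps hpq
    exact ⟨α, Or.inr hα, hα'⟩

theorem eventually_const_mul_rpow_lt (C : ℝ) {e ε : ℝ} (he : e < 0) (hε : 0 < ε) :
    ∀ᶠ x : ℝ in atTop, C * x ^ e < ε := by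
  have h := (tendsto_rpow_neg_atTop (neg_pos.2 he)).const_mul C
  rw [neg_neg, mul_zero] at h
  exact h.eventually_lt_const hε

theorem polyHeight_le {P : ℤ[X]} {B : ℝ} (hB : 0 ≤ B) (h : ∀ i, |(P.coeff i : ℝ)| ≤ B) :
    polyHeight P ≤ B := by
  have h1 : (P.support.sup fun i => (P.coeff i).natAbs) ≤ ⌊B⌋₊ := by
    refine Finset.sup_le fun i _ => Nat.le_floor ?_
    rw [Nat.cast_natAbs, Int.cast_abs]
    exact h i
  exact (Nat.cast_le.2 h1).trans (Nat.floor_le hB)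

theorem mahlerMeasure_le_polyHeight {P : ℤ[X]} {n : ℕ} (hP : P.natDegree ≤ n) :
    (P.map (Int.castRingHom ℂ)).mahlerMeasure ≤ (n + 1) * polyHeight P := by
  have h0 : 0 ≤ polyHeight P := (abs_nonneg _).trans (abs_coeff_le_polyHeight P 0)
  refine (mahlerMeasure_le_sum_norm_coeff _).trans ?_
  rw [sum_over_range' _ (by simp) (n + 1)
    (Nat.lt_succ_of_le ((natDegree_map_le).trans hP))]
  refine (Finset.sum_le_card_nsmul _ _ (polyHeight P) fun i _ => ?_).trans ?_
  · simpa using abs_coeff_le_polyHeight P i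
  · simp

theorem polyHeight_le_mahlerMeasure {P : ℤ[X]} {n : ℕ} (hP : P.natDegree ≤ n) :
    polyHeight P ≤ 2 ^ n * (P.map (Int.castRingHom ℂ)).mahlerMeasure := by
  have h0 := mahlerMeasure_nonneg (P.map (Int.castRingHom ℂ))
  refine polyHeight_le (by positivity) fun i => ?_
  have h := norm_coeff_le_choose_mul_mahlerMeasure i (P.map (Int.castRingHom ℂ))
  rw [coeff_map] at h
  simp only [eq_intCast, Complex.norm_intCast] at h
  refine h.trans ?_
  gcongr
  have h1 : ((P.map (Int.castRingHom ℂ)).natDegree).choose i ≤ 2 ^ n :=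
    (Nat.choose_le_two_pow _ _).trans (Nat.pow_le_pow_right (by norm_num)
      (natDegree_map_le.trans hP))
  exact_mod_cast h1

theorem aeval_ne_zero_of_transcendental {ξ : ℝ} (hξ : Transcendental ℚ ξ) {P : ℤ[X]}
    (hP : P ≠ 0) : aeval ξ P ≠ 0 := fun h =>
  hξ ((IsFractionRing.isAlgebraic_iff ℤ ℚ ℝ).1 ⟨P, hP, h⟩)

/-- Dirichlet's theorem, with a small loss in the exponent. -/
theorem eventually_exists_small_poly {ξ : ℝ} (hξ : Transcendental ℚ ξ) (n : ℕ) :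
    ∀ᶠ H : ℝ in atTop, ∃ P : ℤ[X], P.natDegree ≤ n ∧ polyHeight P ≤ H ∧
      0 < |aeval ξ P| ∧ |aeval ξ P| ≤ H ^ (-((n : ℝ) - 1 / 2)) := by
  set L : ℝ := ∑ i : Fin (n + 1), |ξ| ^ (i : ℕ) with hL
  have hL0 : 0 < L := Finset.sum_pos' (fun i _ => by positivity) ⟨0, by simp⟩
  filter_upwards [eventually_const_mul_rpow_lt (4 * L * 2 ^ n) (e := -(1 / 2)) (by norm_num)
    zero_lt_one, eventually_ge_atTop 2] with H hH hH2
  set N := ⌊H⌋₊ with hN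
  have hNH : (N : ℝ) ≤ H := Nat.floor_le (by linarith)
  have hHN : H / 2 ≤ N := by
    have := Nat.lt_floor_add_one H
    linarith
  have hN1 : (1 : ℝ) ≤ N := by linarith
  have hNpos : (0 : ℝ) < N := by linarith
  let v : (Fin (n + 1) → Fin (N + 1)) → ℝ := fun f => ∑ i, (f i : ℝ) * ξ ^ (i : ℕ)
  have hv : ∀ f, |v f| ≤ L * N := by
    intro f
    refine (Finset.abs_sum_le_sum_abs _ _).trans ?_
    rw [hL, Finset.sum_mul]
    refine Finset.sum_le_sum fun i _ => ?_
    rw [abs_mul, abs_pow, mul_comm, Nat.abs_cast]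
    gcongr
    exact_mod_cast Nat.lt_succ_iff.1 (f i).2
  let b : (Fin (n + 1) → Fin (N + 1)) → ℕ := fun f => ⌊(v f + L * N) * (N ^ n / (4 * L))⌋₊
  have hcard : (Finset.range (N ^ (n + 1))).card <
      (Finset.univ : Finset (Fin (n + 1) → Fin (N + 1))).card := by
    simp only [Finset.card_range, Finset.card_univ, Fintype.card_fun, Fintype.card_fin]
    exact Nat.pow_lt_pow_left (Nat.lt_succ_self N) (Nat.succ_ne_zero n)
  have hmaps : ∀ f ∈ (Finset.univ : Finset (Fin (n + 1) → Fin (N + 1))),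
      b f ∈ Finset.range (N ^ (n + 1)) := by
    intro f _
    rw [Finset.mem_range]
    have h1 := abs_le.1 (hv f)
    rw [Nat.floor_lt (mul_nonneg (by linarith) (by positivity))]
    calc (v f + L * N) * (N ^ n / (4 * L)) ≤ (2 * (L * N)) * (N ^ n / (4 * L)) := by
          gcongr; linarith
      _ = (N : ℝ) ^ (n + 1) / 2 := by field_simp; ring
      _ < _ := by
        push_cast
        exact half_lt_self (by positivity)
  obtain ⟨f, -, g, -, hfg, hb⟩ := Finset.exists_ne_map_eq_of_card_lt_of_maps_to hcard hmaps
  have hclose : |v f - v g| ≤ 4 * L / N ^ n := by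
    have h1 : |(v f + L * N) * (N ^ n / (4 * L)) - (v g + L * N) * (N ^ n / (4 * L))| < 1 := by
      have hf0 : 0 ≤ (v f + L * N) * (N ^ n / (4 * L)) :=
        mul_nonneg (by linarith [(abs_le.1 (hv f)).1]) (by positivity)
      have hg0 : 0 ≤ (v g + L * N) * (N ^ n / (4 * L)) :=
        mul_nonneg (by linarith [(abs_le.1 (hv g)).1]) (by positivity)
      have hb' : ((b f : ℕ) : ℝ) = b g := by rw [hb]
      have h2 := Nat.floor_le hf0
      have h3 := Nat.lt_floor_add_one ((v f + L * N) * (N ^ n / (4 * L)))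
      have h4 := Nat.floor_le hg0
      have h5 := Nat.lt_floor_add_one ((v g + L * N) * (N ^ n / (4 * L)))
      simp only [b] at hb'
      rw [abs_lt]
      constructor <;> linarith
    rw [← sub_mul, add_sub_add_right_eq_sub, abs_mul,
      abs_of_nonneg (a := (N : ℝ) ^ n / (4 * L)) (by positivity)] at h1
    rw [le_div_iff₀ (by positivity)]
    have h6 : |v f - v g| * N ^ n = |v f - v g| * (N ^ n / (4 * L)) * (4 * L) := by
      field_simp
    rw [h6]
    nlinarith
  let P : ℤ[X] := ofFn (n + 1) fun i => ((f i : ℕ) : ℤ) - ((g i : ℕ) : ℤ)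
  have hcoeff : ∀ i : Fin (n + 1), P.coeff i = ((f i : ℕ) : ℤ) - ((g i : ℕ) : ℤ) := fun i => by
    simp only [P]
    rw [ofFn_coeff_eq_val_of_lt _ i.2]
  have hdeg : P.natDegree < n + 1 := ofFn_natDegree_lt (Nat.le_add_left 1 n) _
  have hP0 : P ≠ 0 := by
    intro h0
    refine hfg (funext fun i => Fin.ext ?_)
    have := hcoeff i
    rw [h0, coeff_zero] at this
    omega
  have haeval : aeval ξ P = v f - v g := by
    rw [aeval_eq_sum_range' hdeg, Finset.sum_range, ← Finset.sum_sub_distrib]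
    refine Finset.sum_congr rfl fun i _ => ?_
    rw [hcoeff i, zsmul_eq_mul]
    push_cast
    ring
  refine ⟨P, Nat.lt_succ_iff.1 hdeg, ?_, abs_pos.2 (aeval_ne_zero_of_transcendental hξ hP0), ?_⟩
  · refine polyHeight_le (by linarith) fun i => ?_
    rcases lt_or_ge i (n + 1) with hi | hi
    · rw [hcoeff ⟨i, hi⟩]
      refine le_trans ?_ hNH
      have h1 : ((f ⟨i, hi⟩ : ℕ) : ℝ) ≤ N := by exact_mod_cast Nat.lt_succ_iff.1 (f ⟨i, hi⟩).2
      have h2 : ((g ⟨i, hi⟩ : ℕ) : ℝ) ≤ N := by exact_mod_cast Nat.lt_succ_iff.1 (g ⟨i, hi⟩).2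
      have h3 : (0 : ℝ) ≤ ((f ⟨i, hi⟩ : ℕ) : ℝ) := Nat.cast_nonneg _
      have h4 : (0 : ℝ) ≤ ((g ⟨i, hi⟩ : ℕ) : ℝ) := Nat.cast_nonneg _
      push_cast
      rw [abs_le]
      constructor <;> linarith
    · rw [coeff_eq_zero_of_natDegree_lt (hdeg.trans_le hi)]
      simp only [Int.cast_zero, abs_zero]
      linarith
  · rw [haeval]
    have hHpos : 0 < H := by linarith
    calc |v f - v g| ≤ 4 * L / N ^ n := hclose
      _ ≤ 4 * L / (H / 2) ^ n := by gcongr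
      _ = 4 * L * 2 ^ n * H ^ (-(1 / 2) : ℝ) * H ^ (-((n : ℝ) - 1 / 2)) := by
        rw [mul_assoc (4 * L * 2 ^ n), ← Real.rpow_add hHpos,
          show (-(1 / 2) : ℝ) + -((n : ℝ) - 1 / 2) = -(n : ℝ) by ring, Real.rpow_neg hHpos.le,
          Real.rpow_natCast, div_pow]
        field_simp
      _ ≤ 1 * H ^ (-((n : ℝ) - 1 / 2)) := by gcongr
      _ = _ := one_mul _

theorem exists_irreducible_dvd_of_aeval_eq_zero {P : ℤ[X]} (hP : P ≠ 0) {α : ℝ}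
    (h : aeval α P = 0) : ∃ R : ℤ[X], Irreducible R ∧ R ∣ P ∧ aeval α R = 0 := by
  induction P using WfDvdMonoid.induction_on_irreducible with
  | zero => exact absurd rfl hP
  | unit u hu => exact absurd h (hu.map (aeval α)).ne_zero
  | mul a i ha hi ih =>
    rw [map_mul, mul_eq_zero] at h
    rcases h with h | h
    · exact ⟨i, hi, dvd_mul_right _ _, h⟩
    · obtain ⟨R, hR, hRa, hR0⟩ := ih ha h
      exact ⟨R, hR, hRa.mul_left i, hR0⟩

theorem mahlerMeasure_le_of_dvd {R P : ℤ[X]} (h : R ∣ P) (hP : P ≠ 0) :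
    (R.map (Int.castRingHom ℂ)).mahlerMeasure ≤ (P.map (Int.castRingHom ℂ)).mahlerMeasure := by
  obtain ⟨S, rfl⟩ := h
  rw [Polynomial.map_mul, mahlerMeasure_mul]
  exact le_mul_of_one_le_right (mahlerMeasure_nonneg _)
    (one_le_mahlerMeasure_of_ne_zero (right_ne_zero_of_mul hP))

theorem resultant_ne_zero_of_not_dvd {R Q : ℤ[X]} (hR : Irreducible R) (hdeg : R.natDegree ≠ 0)
    (h : ¬ R ∣ Q) : R.resultant Q ≠ 0 := by
  have hprim := hR.isPrimitive hdeg
  have hirr := (IsPrimitive.Int.irreducible_iff_irreducible_map_cast hprim).1 hR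
  rw [IsPrimitive.Int.dvd_iff_map_cast_dvd_map_cast _ _ hprim] at h
  have h1 := resultant_ne_zero _ _ (hirr.coprime_iff_not_dvd.2 h)
  intro h2
  apply h1
  rw [natDegree_map_eq_of_injective (Int.castRingHom ℚ).injective_int,
    natDegree_map_eq_of_injective (Int.castRingHom ℚ).injective_int, resultant_map_map, h2,
    map_zero]

theorem le_abs_aeval_of_irreducible {ξ δ w : ℝ} {n : ℕ} (hδ : 0 < δ)
    (h : ∀ R : ℤ[X], Irreducible R → R.natDegree ≤ n → δ ^ R.natDegree *
      (R.map (Int.castRingHom ℂ)).mahlerMeasure ^ (-w) ≤ |aeval ξ R|)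
    {P : ℤ[X]} (hP : P ≠ 0) (hdeg : P.natDegree ≤ n) :
    δ ^ P.natDegree * (P.map (Int.castRingHom ℂ)).mahlerMeasure ^ (-w) ≤ |aeval ξ P| := by
  induction P using WfDvdMonoid.induction_on_irreducible with
  | zero => exact absurd rfl hP
  | unit u hu =>
    obtain ⟨c, hc, rfl⟩ := isUnit_iff.1 hu
    rw [natDegree_C, map_C, mahlerMeasure_const, aeval_C]
    rcases Int.isUnit_iff.1 hc with rfl | rfl <;> simp
  | mul a i ha hi ih =>
    rw [natDegree_mul hi.ne_zero ha] at hdeg ⊢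
    rw [Polynomial.map_mul, mahlerMeasure_mul, map_mul, abs_mul, pow_add,
      Real.mul_rpow (mahlerMeasure_nonneg _) (mahlerMeasure_nonneg _), mul_mul_mul_comm]
    have := mahlerMeasure_nonneg (a.map (Int.castRingHom ℂ))
    exact mul_le_mul (h i hi (by omega)) (ih ha (by omega)) (by positivity) (abs_nonneg _)

theorem exists_pos_le_of_finite {ι : Type*} {s : Set ι} (hs : s.Finite) {f : ι → ℝ}
    (hf : ∀ i ∈ s, 0 < f i) : ∃ δ, 0 < δ ∧ δ ≤ 1 ∧ ∀ i ∈ s, δ ≤ f i := by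
  induction s, hs using Set.Finite.induction_on with
  | empty => exact ⟨1, one_pos, le_rfl, by simp⟩
  | @insert a s _ _ ih =>
    obtain ⟨δ, h0, h1, h2⟩ := ih fun i hi => hf i (Set.mem_insert_of_mem _ hi)
    refine ⟨min δ (f a), lt_min h0 (hf a (Set.mem_insert _ _)), (min_le_left _ _).trans h1, ?_⟩
    rintro i (rfl | hi)
    · exact min_le_right _ _
    · exact (min_le_left _ _).trans (h2 i hi)

theorem exists_irreducible_small {ξ w v : ℝ} {n : ℕ} (hξ : Transcendental ℚ ξ)
    (hw : ∀ᶠ H : ℝ in atTop, ∃ P : ℤ[X], P.natDegree ≤ n ∧ polyHeight P ≤ H ∧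
      0 < |aeval ξ P| ∧ |aeval ξ P| ≤ H ^ (-w)) (hv : 0 ≤ v) (hvw : v < w) (B : ℝ) :
    ∃ R : ℤ[X], Irreducible R ∧ R.natDegree ≤ n ∧ R.natDegree ≠ 0 ∧
      |aeval ξ R| < (R.map (Int.castRingHom ℂ)).mahlerMeasure ^ (-v) ∧
      B < (R.map (Int.castRingHom ℂ)).mahlerMeasure := by
  have hconst : ∀ R : ℤ[X], R ≠ 0 → R.natDegree = 0 →
      (R.map (Int.castRingHom ℂ)).mahlerMeasure ^ (-v) ≤ |aeval ξ R| := by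
    intro R hR0 hR
    refine (Real.rpow_le_one_of_one_le_of_nonpos (one_le_mahlerMeasure_of_ne_zero hR0)
      (neg_nonpos.2 hv)).trans ?_
    rw [eq_C_of_natDegree_eq_zero hR] at hR0 ⊢
    rw [aeval_C, eq_intCast]
    exact_mod_cast Int.one_le_abs (C_ne_zero.1 hR0)
  by_contra! hcon
  set F : Set ℤ[X] := {R | R.natDegree ≤ n ∧
    (R.map (Int.castRingHom ℂ)).mahlerMeasure ≤ (B.toNNReal : NNReal)} with hF
  have hfin : F.Finite := finite_mahlerMeasure_le n _
  obtain ⟨δ, hδ0, hδ1, hδ⟩ := exists_pos_le_of_finite (hfin.subset (Set.sdiff_subset (t := {0})))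
    (f := fun R => |aeval ξ R|)
    fun R hR => abs_pos.2 (aeval_ne_zero_of_transcendental hξ hR.2)
  have hlow : ∀ P : ℤ[X], P ≠ 0 → P.natDegree ≤ n →
      δ ^ P.natDegree * (P.map (Int.castRingHom ℂ)).mahlerMeasure ^ (-v) ≤ |aeval ξ P| := by
    intro P hP hPn
    refine le_abs_aeval_of_irreducible hδ0 (fun R hR hRn => ?_) hP hPn
    have hM := one_le_mahlerMeasure_of_ne_zero hR.ne_zero
    have hMv : (R.map (Int.castRingHom ℂ)).mahlerMeasure ^ (-v) ≤ 1 :=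
      Real.rpow_le_one_of_one_le_of_nonpos hM (neg_nonpos.2 hv)
    have hMv0 : 0 ≤ (R.map (Int.castRingHom ℂ)).mahlerMeasure ^ (-v) := by positivity
    have key : (R.map (Int.castRingHom ℂ)).mahlerMeasure ^ (-v) ≤ |aeval ξ R| →
        δ ^ R.natDegree * (R.map (Int.castRingHom ℂ)).mahlerMeasure ^ (-v) ≤ |aeval ξ R| :=
      (mul_le_of_le_one_left hMv0 (pow_le_one₀ hδ0.le hδ1)).trans
    by_cases hd : R.natDegree = 0
    · exact key (hconst R hR.ne_zero hd)
    · by_cases hs : |aeval ξ R| < (R.map (Int.castRingHom ℂ)).mahlerMeasure ^ (-v)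
      · have hB := hcon R hR hRn hd hs
        have hRF : R ∈ F \ {0} := ⟨⟨hRn, hB.trans (Real.le_coe_toNNReal B)⟩, hR.ne_zero⟩
        calc _ ≤ δ ^ R.natDegree * 1 := by gcongr
          _ ≤ δ := by rw [mul_one]; exact pow_le_of_le_one hδ0.le hδ1 hd
          _ ≤ _ := hδ R hRF
      · exact key (not_lt.1 hs)
  obtain ⟨H, ⟨P, hPn, hPH, hP0, hPw⟩, hH, hHpos⟩ := (hw.and
    ((eventually_const_mul_rpow_lt (1 / (δ ^ n * ((n : ℝ) + 1) ^ (-v))) (e := v - w)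
    (by linarith) one_pos).and (eventually_gt_atTop 0))).exists
  have hPne : P ≠ 0 := by
    rintro rfl
    simp at hP0
  have h1 := (hlow P hPne hPn).trans hPw
  have hM1 := one_le_mahlerMeasure_of_ne_zero hPne
  have h2 : δ ^ n * (((n : ℝ) + 1) * H) ^ (-v) ≤ H ^ (-w) := by
    refine le_trans ?_ h1
    have hMH : (P.map (Int.castRingHom ℂ)).mahlerMeasure ≤ ((n : ℝ) + 1) * H :=
      (mahlerMeasure_le_polyHeight hPn).trans (by gcongr)
    have h3 : (((n : ℝ) + 1) * H) ^ (-v) ≤ (P.map (Int.castRingHom ℂ)).mahlerMeasure ^ (-v) :=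
      Real.rpow_le_rpow_of_nonpos (by linarith) hMH (neg_nonpos.2 hv)
    exact mul_le_mul (pow_le_pow_of_le_one hδ0.le hδ1 hPn) h3 (by positivity) (by positivity)
  rw [Real.mul_rpow (by positivity) hHpos.le, ← mul_assoc] at h2
  have h4 : H ^ (v - w) = H ^ (-w) / H ^ (-v) := by
    rw [← Real.rpow_sub hHpos]
    ring_nf
  rw [h4, one_div_mul_eq_div, div_lt_one (by positivity), div_lt_iff₀ (by positivity)] at hH
  linarith

/-- A uniform polynomial exponent `w` yields infinitely many real algebraic approximations with
any exponent below `(3 * w + 1) / 2 - n`, where `n = k + 2`. -/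
theorem infinite_algebraic_approx {ξ w v : ℝ} {k : ℕ} (hξ : Transcendental ℚ ξ)
    (hw : ∀ᶠ H : ℝ in atTop, ∃ P : ℤ[X], P.natDegree ≤ k + 2 ∧ polyHeight P ≤ H ∧
      0 < |aeval ξ P| ∧ |aeval ξ P| ≤ H ^ (-w))
    (hwk : (k : ℝ) + 3 / 2 ≤ w) (hv : 0 < v) (hvw : v < (3 * w + 1) / 2 - (k + 2)) :
    {α : ℝ | ∃ P : ℤ[X], Irreducible P ∧ aeval α P = 0 ∧ P.natDegree ≤ k + 2 ∧
      0 < |ξ - α| ∧ |ξ - α| ≤ polyHeight P ^ (-v - 1)}.Infinite := by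
  obtain ⟨u, hu, huw⟩ : ∃ u, max ((k : ℝ) + 1) ((2 * v + 2 * k + 3) / 3) < u ∧ u < w :=
    exists_between (max_lt (by linarith) (by linarith))
  obtain ⟨huk, huv⟩ := max_lt_iff.1 hu
  have hu0 : 0 ≤ u := by have : (0 : ℝ) ≤ k := Nat.cast_nonneg k; linarith
  set K : ℝ := (1 + |ξ|) ^ (k + 2) with hK
  have hK0 : 0 < K := by positivity
  set c : ℝ := 2 ^ ((k + 2) * (k + 2)) with hc
  intro hfin
  obtain ⟨ε, hε0, -, hε⟩ := exists_pos_le_of_finite hfin (f := fun α => |ξ - α|)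
    fun α hα => by obtain ⟨P, -, -, -, h, -⟩ := hα; exact h
  have hev : ∀ᶠ μ : ℝ in atTop, 1 < μ ∧
      (∃ Q : ℤ[X], Q.natDegree ≤ k + 2 ∧ polyHeight Q ≤ μ / (k + 4) ∧
        0 < |aeval ξ Q| ∧ |aeval ξ Q| ≤ (μ / (k + 4)) ^ (-w)) ∧
      ((k : ℝ) + 4) ^ w * μ ^ (u - w) < 1 ∧
      c * K ^ (2 * k + 2) * μ ^ (2 * k + 2 - 2 * u : ℝ) < 1 ∧
      c * K ^ (2 * k + 1) * μ ^ (2 * k + 1 - 3 * u : ℝ) < 1 ∧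
      c * K ^ (2 * k + 1) * μ ^ (2 * k + 1 - 3 * u : ℝ) < ε ^ 2 ∧
      c * K ^ (2 * k + 1) / ((2 : ℝ) ^ (k + 2)) ^ (-2 * v - 2) *
        μ ^ (2 * k + 3 - 3 * u + 2 * v : ℝ) < 1 := by
    have hk : (0 : ℝ) ≤ k := Nat.cast_nonneg k
    have hdiv : Tendsto (fun μ : ℝ => μ / (k + 4)) atTop atTop :=
      tendsto_id.atTop_div_const (by positivity)
    exact (eventually_gt_atTop 1).and <| (hdiv.eventually hw).and <|
      (eventually_const_mul_rpow_lt _ (by linarith) one_pos).and <|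
      (eventually_const_mul_rpow_lt _ (by linarith) one_pos).and <|
      (eventually_const_mul_rpow_lt _ (by linarith) one_pos).and <|
      (eventually_const_mul_rpow_lt _ (by linarith) (by positivity)).and <|
      eventually_const_mul_rpow_lt _ (by linarith) one_pos
  obtain ⟨B, hB⟩ := eventually_atTop.1 hev
  obtain ⟨R, hR, hRn, hR0, hRu, hBR⟩ := exists_irreducible_small hξ hw hu0 huw B
  set μ := (R.map (Int.castRingHom ℂ)).mahlerMeasure with hμ
  obtain ⟨hμ1, ⟨Q, hQn, hQH, hQ0, hQw⟩, h₀, h₁, h₂, h₃, h₄⟩ := hB μ hBR.le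
  have hμ0 : 0 < μ := by linarith
  have hQne : Q ≠ 0 := by
    rintro rfl
    simp at hQ0
  have hQμ : (Q.map (Int.castRingHom ℂ)).mahlerMeasure < μ := by
    refine (mahlerMeasure_le_polyHeight hQn).trans_lt ?_
    rw [le_div_iff₀ (by positivity)] at hQH
    have := one_le_polyHeight hQne
    push_cast
    linarith
  have hRQ : ¬ R ∣ Q := fun h => (mahlerMeasure_le_of_dvd h hQne).not_gt hQμ
  have hQu : |aeval ξ Q| ≤ μ ^ (-u) := by
    refine hQw.trans ?_
    rw [Real.div_rpow hμ0.le (by positivity), Real.rpow_neg (by positivity : (0 : ℝ) ≤ k + 4),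
      div_inv_eq_mul]
    have h5 : μ ^ (-w) = μ ^ (u - w) * μ ^ (-u) := by
      rw [← Real.rpow_add hμ0]
      ring_nf
    rw [h5, mul_right_comm, mul_comm (μ ^ (u - w))]
    exact mul_le_of_le_one_left (by positivity) h₀.le
  have hshift : ∀ P : ℤ[X], P.natDegree ≤ k + 2 →
      (P.map (Int.castRingHom ℂ)).mahlerMeasure ≤ μ →
      shiftedMeasure ξ (P.map (Int.castRingHom ℂ)) ≤ K * μ := fun P hP h =>
    (shiftedMeasure_le ξ _ (natDegree_map_le.trans hP)).trans (by gcongr)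
  have e₁ : c * (K * μ) ^ (2 * k + 2) * (μ ^ (-u)) ^ 2 =
      c * K ^ (2 * k + 2) * μ ^ (2 * k + 2 - 2 * u : ℝ) := by
    rw [mul_pow, ← mul_assoc, mul_assoc _ (μ ^ _), ← Real.rpow_natCast μ,
      ← Real.rpow_mul_natCast hμ0.le, ← Real.rpow_add hμ0]
    congr 2
    push_cast
    ring
  have e₂ : c * (K * μ) ^ (2 * k + 1) * (μ ^ (-u)) ^ 3 =
      c * K ^ (2 * k + 1) * μ ^ (2 * k + 1 - 3 * u : ℝ) := by
    rw [mul_pow, ← mul_assoc, mul_assoc _ (μ ^ _), ← Real.rpow_natCast μ,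
      ← Real.rpow_mul_natCast hμ0.le, ← Real.rpow_add hμ0]
    congr 2
    push_cast
    ring
  obtain ⟨α, hα, hdist⟩ := exists_real_root hRn hQn (resultant_ne_zero_of_not_dvd hR hR0 hRQ)
    hR.ne_zero hQne (hshift R hRn le_rfl) (hshift Q hQn hQμ.le) hRu.le hQu
    (by rw [← hc, e₁]; exact h₁) (by rw [← hc, e₂]; exact h₂)
  rw [← hc, e₂] at hdist
  obtain ⟨S, hS, hSα, hSn, hSμ⟩ : ∃ S : ℤ[X], Irreducible S ∧ aeval α S = 0 ∧
      S.natDegree ≤ k + 2 ∧ (S.map (Int.castRingHom ℂ)).mahlerMeasure ≤ μ := by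
    rcases hα with hα | hα
    · exact ⟨R, hR, hα, hRn, le_rfl⟩
    · obtain ⟨S, hS, hSQ, hSα⟩ := exists_irreducible_dvd_of_aeval_eq_zero hQne hα
      exact ⟨S, hS, hSα, (natDegree_le_of_dvd hSQ hQne).trans hQn,
        (mahlerMeasure_le_of_dvd hSQ hQne).trans hQμ.le⟩
  have hne : ξ ≠ α := by
    rintro rfl
    exact aeval_ne_zero_of_transcendental hξ hS.ne_zero hSα
  have hpos : 0 < |ξ - α| := abs_pos.2 (sub_ne_zero.2 hne)
  have hle : |ξ - α| ≤ polyHeight S ^ (-v - 1) := by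
    have hS1 := one_le_polyHeight hS.ne_zero
    have hSH : polyHeight S ≤ 2 ^ (k + 2) * μ :=
      (polyHeight_le_mahlerMeasure hSn).trans (by gcongr)
    refine le_of_sq_le_sq (hdist.trans ?_) (by positivity)
    rw [div_mul_eq_mul_div, div_lt_one (by positivity)] at h₄
    calc c * K ^ (2 * k + 1) * μ ^ (2 * k + 1 - 3 * u : ℝ)
        = c * K ^ (2 * k + 1) * μ ^ (2 * k + 3 - 3 * u + 2 * v : ℝ) * μ ^ (-2 * v - 2) := by
          rw [mul_assoc _ (μ ^ _), ← Real.rpow_add hμ0]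
          ring_nf
      _ ≤ ((2 : ℝ) ^ (k + 2)) ^ (-2 * v - 2) * μ ^ (-2 * v - 2) := by gcongr
      _ = (2 ^ (k + 2) * μ) ^ (-2 * v - 2) := (Real.mul_rpow (by positivity) hμ0.le).symm
      _ ≤ polyHeight S ^ (-2 * v - 2) :=
          Real.rpow_le_rpow_of_nonpos (by linarith) hSH (by linarith)
      _ = (polyHeight S ^ (-v - 1)) ^ 2 := by
          rw [← Real.rpow_mul_natCast (by linarith)]
          push_cast
          ring_nf
  have := hε α ⟨S, hS, hSα, hSn, hpos, hle⟩
  have := pow_le_pow_left₀ hε0.le this 2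
  linarith

theorem stmt14 (n : ℕ) (hn : 2 ≤ n) (ξ : ℝ) (hξ : Transcendental ℚ ξ) :
    whExp n ξ ≤ (2 * (wStarExp n ξ + (n : EReal)) - 1) / 3 := by
  obtain ⟨k, rfl⟩ := Nat.exists_eq_add_of_le' hn
  have key : ∀ w : ℝ, (k : ℝ) + 3 / 2 ≤ w → (∀ᶠ H : ℝ in atTop, ∃ P : ℤ[X],
      P.natDegree ≤ k + 2 ∧ polyHeight P ≤ H ∧ 0 < |aeval ξ P| ∧ |aeval ξ P| ≤ H ^ (-w)) →
      (w : EReal) ≤ (2 * (wStarExp (k + 2) ξ + ((k + 2 : ℕ) : EReal)) - 1) / 3 := by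
    intro w hwk hw
    have hk : (0 : ℝ) ≤ k := Nat.cast_nonneg k
    have hstar : (((3 * w + 1) / 2 - (k + 2) : ℝ) : EReal) ≤ wStarExp (k + 2) ξ := by
      by_contra! hlt
      obtain ⟨v, hv₁, hv₂⟩ := EReal.lt_iff_exists_real_btwn.1 hlt
      rw [EReal.coe_lt_coe_iff] at hv₂
      refine hv₁.not_ge ((EReal.coe_le_coe_iff.2 (le_max_left v (1 / 2))).trans (le_sSup ?_))
      exact ⟨_, rfl, infinite_algebraic_approx hξ hw hwk (lt_max_of_lt_right one_half_pos)
        (max_lt hv₂ (by linarith))⟩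
    have hw_eq : (w : EReal) = (2 * ((((3 * w + 1) / 2 - (k + 2) : ℝ) : EReal) +
        ((k + 2 : ℕ) : EReal)) - 1) / 3 := by
      have h : w = (2 * (((3 * w + 1) / 2 - (k + 2)) + ((k + 2 : ℕ) : ℝ)) - 1) / 3 := by
        push_cast
        ring
      nth_rw 1 [h]
      rw [EReal.coe_div, EReal.coe_sub, EReal.coe_mul, EReal.coe_add]
      rfl
    rw [hw_eq]
    refine EReal.div_le_div_right_of_nonneg (by norm_num) (EReal.sub_le_sub ?_ le_rfl)
    gcongr
  refine sSup_le ?_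
  rintro _ ⟨w, rfl, hw⟩
  rcases le_total ((k : ℝ) + 3 / 2) w with h | h
  · exact key w h hw
  · refine (EReal.coe_le_coe_iff.2 h).trans (key _ le_rfl ?_)
    rw [show (k : ℝ) + 3 / 2 = ((k + 2 : ℕ) : ℝ) - 1 / 2 by push_cast; ring]
    exact eventually_exists_small_poly hξ (k + 2)
end
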